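/- Let W be a d×n real matrix with nonnegative entries, x ∈ ℝ^d with nonnegative entries, λ > 0, τ > 0, and let {g_1, …, g_B} be a partition of {1, …, n} into disjoint blocks. Define L(h) = ‖x − Wh‖₂² + λ·Σ_{b=1}^B log(τ + Σ_{i ∈ g_b} h_i²). Let h̄ ∈ ℝ^n have strictly positive entries, suppose each denominator (WᵀWh̄)_i + λ·h̄_i/(τ + Σ_{k ∈ g_{b(i)}} h̄_k²) is strictly positive (where b(i) denotes the index of the block containing i), and define the block reweighted ℓ₂ multiplicative update h⁺_i = h̄_i·(Wᵀx)_i / ((WᵀWh̄)_i + λ·h̄_i/(τ + Σ_{k ∈ g_{b(i)}} h̄_k²)). Then every entry of h⁺ is nonnegative and L(h⁺) ≤ L(h̄). -/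

import Mathlib

open Matrix BigOperators

/-- Separable majorization of `‖W h‖²` at a positive point `u`, for a non-negative matrix `W`. -/
theorem sum_sq_mulVec_le {m n : Type*} [Fintype m] [Fintype n] (W : Matrix m n ℝ)
    (hW : ∀ i j, 0 ≤ W i j) {u : n → ℝ} (hu : ∀ j, 0 < u j) (h : n → ℝ) :
    ∑ i, W.mulVec h i ^ 2 ≤ ∑ j, (Wᵀ * W).mulVec u j / u j * h j ^ 2 := by
  have row (i : m) : W.mulVec h i ^ 2 ≤ W.mulVec u i * ∑ j, W i j * (h j ^ 2 / u j) :=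
    Finset.sum_sq_le_sum_mul_sum_of_sq_le_mul Finset.univ
      (fun j _ => mul_nonneg (hW i j) (hu j).le)
      (fun j _ => mul_nonneg (hW i j) (div_nonneg (sq_nonneg _) (hu j).le))
      (fun j _ => le_of_eq (by have := (hu j).ne'; field_simp))
  refine (Finset.sum_le_sum fun i _ => row i).trans_eq ?_
  simp only [Finset.mul_sum]
  rw [Finset.sum_comm]
  refine Finset.sum_congr rfl fun j _ => ?_
  rw [← Matrix.mulVec_mulVec]
  simp only [Matrix.mulVec, dotProduct, Matrix.transpose_apply, Finset.sum_div, Finset.sum_mul]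
  refine Finset.sum_congr rfl fun i _ => ?_
  simp only [Finset.mul_sum, Finset.sum_mul, Finset.sum_div]
  exact Finset.sum_congr rfl fun k _ => by ring

theorem sum_sq_mulVec_eq {m n : Type*} [Fintype m] [Fintype n] (W : Matrix m n ℝ)
    {u : n → ℝ} (hu : ∀ j, 0 < u j) :
    ∑ i, W.mulVec u i ^ 2 = ∑ j, (Wᵀ * W).mulVec u j / u j * u j ^ 2 := by
  have h₁ : ∑ i, W.mulVec u i ^ 2 = W.mulVec u ⬝ᵥ W.mulVec u := by
    simp only [dotProduct, sq]
  rw [h₁, Matrix.dotProduct_mulVec, ← Matrix.mulVec_transpose, Matrix.mulVec_mulVec]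
  refine Finset.sum_congr rfl fun j _ => ?_
  have := (hu j).ne'
  field_simp

theorem sum_sub_mulVec_sq {m n : Type*} [Fintype m] [Fintype n] (W : Matrix m n ℝ)
    (x : m → ℝ) (h : n → ℝ) :
    ∑ i, (x i - W.mulVec h i) ^ 2 =
      ∑ i, x i ^ 2 - 2 * ∑ j, Wᵀ.mulVec x j * h j + ∑ i, W.mulVec h i ^ 2 := by
  have h₁ : ∑ j, Wᵀ.mulVec x j * h j = ∑ i, x i * W.mulVec h i := by
    rw [Matrix.mulVec_transpose]
    exact (Matrix.dotProduct_mulVec x W h).symm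
  rw [h₁, Finset.mul_sum, ← Finset.sum_sub_distrib, ← Finset.sum_add_distrib]
  exact Finset.sum_congr rfl fun i _ => by ring

/-- The tangent-line bound for the logarithm. -/
theorem log_sub_log_le_sub_div {a b : ℝ} (ha : 0 < a) (hb : 0 < b) :
    Real.log a - Real.log b ≤ (a - b) / b := by
  rw [← Real.log_div ha.ne' hb.ne', sub_div, div_self hb.ne']
  exact Real.log_le_sub_one_of_pos (div_pos ha hb)

/-- Majorization of the block log penalty by a weighted sum of squares. -/
theorem sum_log_block_sub_le {n β : Type*} [Fintype n] [Fintype β] [DecidableEq β]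
    (blk : n → β) {τ : ℝ} (hτ : 0 < τ) (h u : n → ℝ) :
    ∑ b, Real.log (τ + ∑ k ∈ Finset.univ.filter (fun k => blk k = b), h k ^ 2) -
      ∑ b, Real.log (τ + ∑ k ∈ Finset.univ.filter (fun k => blk k = b), u k ^ 2) ≤
    ∑ j, (h j ^ 2 - u j ^ 2) /
      (τ + ∑ k ∈ Finset.univ.filter (fun k => blk k = blk j), u k ^ 2) := by
  have pos (v : n → ℝ) (b : β) :
      0 < τ + ∑ k ∈ Finset.univ.filter (fun k => blk k = b), v k ^ 2 :=
    add_pos_of_pos_of_nonneg hτ (Finset.sum_nonneg fun _ _ => sq_nonneg _)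
  rw [← Finset.sum_sub_distrib, ← Finset.sum_fiberwise Finset.univ blk]
  refine Finset.sum_le_sum fun b _ => (log_sub_log_le_sub_div (pos h b) (pos u b)).trans_eq ?_
  rw [add_sub_add_left_eq_sub, ← Finset.sum_sub_distrib, Finset.sum_div]
  refine Finset.sum_congr rfl fun j hj => ?_
  rw [(Finset.mem_filter.mp hj).2]

/-- The block reweighted ℓ₂ multiplicative update preserves non-negativity and does
not increase the block-sparse S-NNLS objective (block rectified Student's-t prior).
The partition of `{1,…,n}` into `B` disjoint blocks is encoded by the block
assignment map `blk`, with block `g_b = blk ⁻¹ {b}`. -/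
theorem stmt_17 (d n B : ℕ)
    (W : Matrix (Fin d) (Fin n) ℝ) (hW : ∀ i j, 0 ≤ W i j)
    (x : Fin d → ℝ) (hx : ∀ i, 0 ≤ x i)
    (lam τ : ℝ) (hlam : 0 < lam) (hτ : 0 < τ)
    (blk : Fin n → Fin B)
    (L : (Fin n → ℝ) → ℝ)
    (hL : ∀ h, L h = ∑ i, (x i - W.mulVec h i) ^ 2 +
      lam * ∑ b : Fin B,
        Real.log (τ + ∑ k ∈ Finset.univ.filter (fun k => blk k = b), h k ^ 2))
    (hbar : Fin n → ℝ) (hpos : ∀ i, 0 < hbar i)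
    (hden : ∀ i, 0 < (Wᵀ * W).mulVec hbar i +
      lam * hbar i / (τ + ∑ k ∈ Finset.univ.filter (fun k => blk k = blk i), hbar k ^ 2))
    (hplus : Fin n → ℝ)
    (hplusdef : ∀ i, hplus i =
      hbar i * Wᵀ.mulVec x i /
        ((Wᵀ * W).mulVec hbar i +
          lam * hbar i /
            (τ + ∑ k ∈ Finset.univ.filter (fun k => blk k = blk i), hbar k ^ 2))) :
    (∀ i, 0 ≤ hplus i) ∧ L hplus ≤ L hbar := by
  have hc (i : Fin n) : 0 ≤ Wᵀ.mulVec x i := by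
    simp only [Matrix.mulVec, dotProduct, Matrix.transpose_apply]
    exact Finset.sum_nonneg fun k _ => mul_nonneg (hW k i) (hx k)
  refine ⟨fun i => ?_, ?_⟩
  · rw [hplusdef]
    exact div_nonneg (mul_nonneg (hpos i).le (hc i)) (hden i).le
  have quad := sum_sq_mulVec_le W hW hpos hplus
  have quad_eq := sum_sq_mulVec_eq W hpos
  have pen := mul_le_mul_of_nonneg_left (sum_log_block_sub_le blk hτ hplus hbar) hlam.le
  have descent : ∑ j, (-2 * (Wᵀ.mulVec x j * hplus j) + 2 * (Wᵀ.mulVec x j * hbar j) +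
      (Wᵀ * W).mulVec hbar j / hbar j * hplus j ^ 2 -
      (Wᵀ * W).mulVec hbar j / hbar j * hbar j ^ 2 +
      lam * ((hplus j ^ 2 - hbar j ^ 2) /
        (τ + ∑ k ∈ Finset.univ.filter (fun k => blk k = blk j), hbar k ^ 2))) ≤ 0 := by
    refine Finset.sum_nonpos fun j _ => ?_
    have hj := hplusdef j
    have hd := hden j
    have hu := hpos j
    have hs : 0 < τ + ∑ k ∈ Finset.univ.filter (fun k => blk k = blk j), hbar k ^ 2 :=
      add_pos_of_pos_of_nonneg hτ (Finset.sum_nonneg fun _ _ => sq_nonneg _)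
    generalize τ + ∑ k ∈ Finset.univ.filter (fun k => blk k = blk j), hbar k ^ 2 = s at *
    generalize (Wᵀ * W).mulVec hbar j = a at *
    have hcj : Wᵀ.mulVec x j = (a + lam * hbar j / s) * hplus j / hbar j := by
      rw [hj, mul_div_cancel₀ _ hd.ne', mul_div_cancel_left₀ _ hu.ne']
    calc _ = -((a + lam * hbar j / s) / hbar j * (hplus j - hbar j) ^ 2) := by
            rw [hcj]
            field_simp
            ring
      _ ≤ 0 := neg_nonpos.mpr (mul_nonneg (div_pos hd hu).le (sq_nonneg _))
  simp only [Finset.sum_add_distrib, Finset.sum_sub_distrib, ← Finset.mul_sum] at descent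
  rw [hL, hL, sum_sub_mulVec_sq, sum_sub_mulVec_sq]
  linarith
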